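/- arXiv:1505.07017 — 7 statements merged into one kernel-verified Lean document; each statement's English description precedes it below -/
import Mathlib

section
/- Let U ⊆ ℝ^m be open, X : U → ℝ^m continuously differentiable, and x* ∈ U a point with X(x*) = 0 such that every eigenvalue of the linearization DX(x*) : ℝ^m → ℝ^m (i.e., every complex root of its characteristic polynomial) has negative real part. Let Y : (0,∞) × U → ℝ^m be a bounded continuous map. Then there exist s₁ > 0 and an open set V ⊆ U containing x* such that for every s₀ > s₁ and every x₀ ∈ V, any maximally extended solution x(s) of the Cauchy problem dx/ds = X(x) + (1/s)Y(s,x) for s ≥ s₀ with x(s₀) = x₀ exists for all s ≥ s₀ and satisfies lim_{s→∞} x(s) = x*. -/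
open Set Filter Topology

theorem aux_arith {c ν C p r K : ℝ} (hc : 0 < c) (hν : ν < 0) 
    (hK : K = C ^ 2 / (c * (-ν)) + 1) :
    -c * p ^ 2 + r * C * p + K * ν * r ^ 2 ≤ -(min (c / 2) (-ν / 2)) * (p ^ 2 + K * r ^ 2) := by
  have hν' : 0 < -ν := by linarith
  have hKpos : 0 < K := by rw [hK]; positivity
  have h1 : K * (-ν) = C ^ 2 / c + (-ν) := by rw [hK]; have := hν.ne; field_simp; ring
  have h2 : r * C * p ≤ c / 2 * p ^ 2 + C ^ 2 / c * r ^ 2 / 2 := by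
    have h : 0 ≤ (c * p - r * C) ^ 2 / (2 * c) := by positivity
    have h' : (c * p - r * C) ^ 2 / (2 * c)
      = c / 2 * p ^ 2 - r * C * p + C ^ 2 / c * r ^ 2 / 2 := by field_simp; ring
    linarith
  have h3 : C ^ 2 / c * r ^ 2 ≤ K * (-ν) * r ^ 2 := by
    rw [h1]; nlinarith [mul_nonneg hν'.le (sq_nonneg r)]
  have h4 : min (c / 2) (-ν / 2) * p ^ 2 ≤ c / 2 * p ^ 2 :=
    mul_le_mul_of_nonneg_right (min_le_left _ _) (sq_nonneg p)
  have h5 : min (c / 2) (-ν / 2) * (K * r ^ 2) ≤ -ν / 2 * (K * r ^ 2) :=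
    mul_le_mul_of_nonneg_right (min_le_right _ _) (by positivity)
  nlinarith

theorem lyap_complex (n : ℕ) : ∀ (V : Type) [AddCommGroup V] [Module ℂ V] [FiniteDimensional ℂ V]
    (_ : Module.finrank ℂ V = n) (T : V →ₗ[ℂ] V)
    (_ : ∀ μ : ℂ, Module.End.HasEigenvalue T μ → μ.re < 0),
    ∃ (H : Type) (_ : NormedAddCommGroup H) (_ : InnerProductSpace ℂ H) (g : V →ₗ[ℂ] H) (c : ℝ),
      0 < c ∧ Function.Injective g ∧ ∀ x, (inner ℂ (g (T x)) (g x)).re ≤ -c * ‖g x‖ ^ 2 := by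
  induction n using Nat.strong_induction_on with
  | _ n ih =>
  intro V _ _ _ hn T hT
  rcases subsingleton_or_nontrivial V with hs | hs
  · refine ⟨ℂ, inferInstance, inferInstance, 0, 1, one_pos, fun x y _ => Subsingleton.elim _ _, ?_⟩
    intro x; simp
  obtain ⟨μ, hμ⟩ := Module.End.exists_eigenvalue (K := ℂ) (V := Module.Dual ℂ V)
    (Module.Dual.transpose (R := ℂ) T)
  obtain ⟨f, hf⟩ := hμ.exists_hasEigenvector
  have hfT : ∀ x, f (T x) = μ * f x := by
    intro x
    have := LinearMap.congr_fun hf.apply_eq_smul x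
    simpa [Module.Dual.transpose_apply] using this
  have hf0 : f ≠ 0 := hf.2
  have hμre : μ.re < 0 := by
    apply hT
    by_contra hcon
    have hinj : Function.Injective (T - algebraMap ℂ (Module.End ℂ V) μ) := by
      rw [← LinearMap.ker_eq_bot]
      by_contra h
      apply hcon
      rw [Module.End.hasEigenvalue_iff, Module.End.eigenspace_def]
      exact h
    have hsur := LinearMap.injective_iff_surjective.1 hinj
    apply hf0
    ext y
    obtain ⟨z, rfl⟩ := hsur y
    simp [hfT]
  obtain ⟨u0, hu0⟩ : ∃ u, f u ≠ 0 := by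
    by_contra! h
    exact hf0 (LinearMap.ext h)
  obtain ⟨u, hu⟩ : ∃ u, f u = 1 := ⟨(f u0)⁻¹ • u0, by simp [hu0]⟩
  let W := LinearMap.ker f
  have hTW : ∀ x ∈ W, T x ∈ W := by
    intro x hx
    have : f x = 0 := hx
    change f (T x) = 0
    simp [hfT, this]
  have hlt : Module.finrank ℂ W < n := by
    rw [← hn]
    apply Submodule.finrank_lt
    intro h
    exact hf0 (LinearMap.ker_eq_top.1 h)
  obtain ⟨H, _, _, g, c, hc, hg, hgT⟩ := ih _ hlt W rfl (T.restrict hTW) (by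
    intro ν hν
    apply hT
    obtain ⟨w, hw⟩ := hν.exists_hasEigenvector
    refine Module.End.hasEigenvalue_of_hasEigenvector (x := (w : V)) ⟨?_, ?_⟩
    · rw [Module.End.mem_eigenspace_iff]
      have := congrArg Subtype.val hw.apply_eq_smul
      simpa using this
    · simpa using hw.2)
  let π : V →ₗ[ℂ] W := LinearMap.codRestrict W (LinearMap.id - f.smulRight u) (by
    intro x
    change f (x - f x • u) = 0
    simp [hu])
  have hπ : ∀ x, ((π x : W) : V) = x - f x • u := fun x => rfl
  have hπT : ∀ x, π (T x) = (T.restrict hTW) (π x) + f x • π (T u) := by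
    intro x
    apply Subtype.ext
    simp only [hπ, Submodule.coe_add, Submodule.coe_smul, LinearMap.coe_restrict_apply, hfT, hu,
      map_sub, map_smul]
    module
  set K : ℝ := ‖g (π (T u))‖ ^ 2 / (c * (-μ.re)) + 1 with hK
  have hKpos : 0 < K := by
    have : 0 < -μ.re := by linarith
    positivity
  let G : V →ₗ[ℂ] WithLp 2 (H × ℂ) := (WithLp.linearEquiv 2 ℂ (H × ℂ)).symm.toLinearMap ∘ₗ
    LinearMap.prod (g ∘ₗ π) (((Real.sqrt K : ℝ) : ℂ) • f)
  have hG1 : ∀ x, (G x).fst = g (π x) := fun x => rfl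
  have hG2 : ∀ x, (G x).snd = ((Real.sqrt K : ℝ) : ℂ) * f x := fun x => rfl
  have hnorm : ∀ x, ‖G x‖ ^ 2 = ‖g (π x)‖ ^ 2 + K * ‖f x‖ ^ 2 := by
    intro x
    rw [WithLp.prod_norm_sq_eq_of_L2, hG1, hG2, norm_mul, mul_pow]
    simp [Real.sq_sqrt hKpos.le]
  refine ⟨WithLp 2 (H × ℂ), inferInstance, inferInstance, G, min (c / 2) (-μ.re / 2), ?_, ?_, ?_⟩
  · apply lt_min <;> linarith
  · rw [← LinearMap.ker_eq_bot, LinearMap.ker_eq_bot']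
    intro x hx
    have h := hnorm x
    rw [hx, norm_zero] at h
    have h1 : ‖g (π x)‖ ^ 2 = 0 := by nlinarith [sq_nonneg ‖g (π x)‖, mul_nonneg hKpos.le (sq_nonneg ‖f x‖)]
    have h2 : K * ‖f x‖ ^ 2 = 0 := by nlinarith [sq_nonneg ‖g (π x)‖, mul_nonneg hKpos.le (sq_nonneg ‖f x‖)]
    have h3 : f x = 0 := by simpa [hKpos.ne'] using h2
    have h4 : g (π x) = 0 := by simpa using h1
    have h5 : π x = 0 := hg (by rw [h4, map_zero])
    have h6 := hπ x
    rw [h5, h3] at h6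
    simpa using h6.symm
  · intro x
    rw [hnorm, WithLp.prod_inner_apply, Complex.add_re]
    change (inner ℂ (g (π (T x))) (g (π x))).re + 
      (inner ℂ (((Real.sqrt K : ℝ) : ℂ) * f (T x)) (((Real.sqrt K : ℝ) : ℂ) * f x)).re ≤ _
    have e2 : (inner ℂ (((Real.sqrt K : ℝ) : ℂ) * f (T x)) (((Real.sqrt K : ℝ) : ℂ) * f x)).re
        = K * μ.re * ‖f x‖ ^ 2 := by
      rw [hfT, ← Complex.normSq_eq_norm_sq, Complex.normSq_apply]
      nth_rewrite 3 [← Real.sq_sqrt hKpos.le]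
      simp
      ring
    have e1 : (inner ℂ (g (π (T x))) (g (π x))).re ≤
        -c * ‖g (π x)‖ ^ 2 + ‖f x‖ * ‖g (π (T u))‖ * ‖g (π x)‖ := by
      rw [hπT, map_add, inner_add_left, Complex.add_re]
      apply add_le_add (hgT _)
      refine (Complex.re_le_norm _).trans ((norm_inner_le_norm _ _).trans ?_)
      rw [map_smul, norm_smul]
    rw [e2]
    refine le_trans (add_le_add_left e1 _) ?_
    exact aux_arith hc hμre hK

theorem lyap_real {m : ℕ} (A : (Fin m → ℝ) →L[ℝ] (Fin m → ℝ))
    (hEig : ∀ z : ℂ,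
      (((LinearMap.toMatrix' (A :
          (Fin m → ℝ) →ₗ[ℝ] (Fin m → ℝ))).map Complex.ofReal).charpoly).IsRoot z →
        z.re < 0) :
    ∃ (H : Type) (_ : NormedAddCommGroup H) (_ : InnerProductSpace ℝ H) 
      (L : (Fin m → ℝ) →L[ℝ] H) (c a : ℝ), 0 < c ∧ 0 < a ∧ (∀ x, ‖x‖ ≤ a * ‖L x‖) ∧
      ∀ x, inner ℝ (L x) (L (A x)) ≤ -c * ‖L x‖ ^ 2 := by
  set M := LinearMap.toMatrix' (A : (Fin m → ℝ) →ₗ[ℝ] (Fin m → ℝ)) with hM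
  obtain ⟨H, _, _, g, c, hc, hg, hgT⟩ := lyap_complex _ (Fin m → ℂ) rfl
    (Matrix.toLin' (M.map Complex.ofReal)) (by
      intro μ hμ
      rw [Module.End.hasEigenvalue_iff_isRoot_charpoly, Matrix.charpoly_toLin'] at hμ
      exact hEig μ hμ)
  let _ : InnerProductSpace ℝ H := InnerProductSpace.rclikeToReal ℂ H
  let ι : (Fin m → ℝ) →ₗ[ℝ] (Fin m → ℂ) :=
    { toFun := fun x i => (x i : ℂ)
      map_add' := by intro x y; ext i; simp
      map_smul' := by intro x y; ext i; simp }
  have hιA : ∀ x, ι (A x) = Matrix.toLin' (M.map Complex.ofReal) (ι x) := by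
    intro x
    have h1 : A x = M.mulVec x := by
      rw [hM, LinearMap.toMatrix'_mulVec]; rfl
    ext i
    rw [h1]
    simp [ι, Matrix.mulVec, dotProduct]
  let L0 : (Fin m → ℝ) →ₗ[ℝ] H :=
    { toFun := fun x => g (ι x)
      map_add' := by intro x y; simp
      map_smul' := by
        intro r x
        rw [map_smul, ← Complex.coe_smul, map_smul]
        rfl }
  have hker : LinearMap.ker L0 = ⊥ := by
    rw [LinearMap.ker_eq_bot]
    intro x y hxy
    have := hg (show g (ι x) = g (ι y) from hxy)
    ext i
    have := congrFun this i
    simpa [ι] using this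
  obtain ⟨K, hK, hL⟩ := LinearMap.exists_antilipschitzWith L0 hker
  refine ⟨H, inferInstance, inferInstance, LinearMap.toContinuousLinearMap L0, c, K, hc,
    by exact_mod_cast hK, ?_, ?_⟩
  · intro x
    have := hL.le_mul_dist x 0
    simpa using this
  · intro x
    have h := hgT (ι x)
    rw [← hιA] at h
    rw [real_inner_comm]
    exact h

theorem delay_approx {E : Type*} [NormedAddCommGroup E] [NormedSpace ℝ E] [CompleteSpace E]
    (G : ℝ → E → E) (hG : Continuous (fun p : ℝ × E => G p.1 p.2)) (C : ℝ)
    (hC : ∀ t x, ‖G t x‖ ≤ C) (b : ℝ) (y0 : E) (h : ℝ) (k : ℕ) :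
    ∃ φ : ℝ → E, Continuous φ ∧ (∀ t ≤ b, φ t = y0) ∧ (∀ s t, ‖φ s - φ t‖ ≤ C * |s - t|) ∧
      ∀ t ∈ Icc b (b + k * h), φ t = y0 + ∫ u in b..t, G u (φ (u - h)) := by
  have hC0 : 0 ≤ C := (norm_nonneg _).trans (hC 0 0)
  induction k with
  | zero =>
    refine ⟨fun _ => y0, continuous_const, fun _ _ => rfl, ?_, ?_⟩
    · intro s t; simp; positivity
    · intro t ht
      have : t = b := by simpa using ht
      simp [this]
  | succ k ih =>
    obtain ⟨φ, hφ, hφb, -, hφe⟩ := ih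
    have hcont : Continuous (fun u => G u (φ (u - h))) :=
      hG.comp (continuous_id.prodMk (hφ.comp (continuous_id.sub continuous_const)))
    let ψ : ℝ → E := fun t => y0 + ∫ u in b..(max t b), G u (φ (u - h))
    have hlip : ∀ s t, ‖ψ s - ψ t‖ ≤ C * |s - t| := by
      intro s t
      have h1 : ψ s - ψ t = ∫ u in (max t b)..(max s b), G u (φ (u - h)) := by
        simp only [ψ, add_sub_add_left_eq_sub]
        exact intervalIntegral.integral_interval_sub_left (hcont.intervalIntegrable _ _)
          (hcont.intervalIntegrable _ _)
      rw [h1]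
      refine (intervalIntegral.norm_integral_le_of_norm_le_const (fun u _ => hC _ _)).trans ?_
      exact mul_le_mul_of_nonneg_left (abs_max_sub_max_le_abs s t b) hC0
    have heq : ∀ t ≤ b + k * h, ψ t = φ t := by
      intro t ht
      rcases le_total t b with h1 | h1
      · simp [ψ, h1, hφb]
      · rw [hφe t ⟨h1, ht⟩]
        simp [ψ, h1]
    refine ⟨ψ, ?_, ?_, hlip, ?_⟩
    · exact (LipschitzWith.of_dist_le_mul (K := ⟨C, hC0⟩) (by
        intro s t; rw [dist_eq_norm, Real.dist_eq]; exact hlip s t)).continuous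
    · intro t ht; simp [ψ, ht]
    · intro t ht
      simp only [ψ, max_eq_left ht.1]
      congr 1
      apply intervalIntegral.integral_congr
      intro u hu
      rw [uIcc_of_le ht.1] at hu
      have h2 := ht.2
      push_cast at h2
      simp only
      rw [← heq (u - h) (by linarith [hu.2])]

theorem peano {E : Type*} [NormedAddCommGroup E] [NormedSpace ℝ E] [FiniteDimensional ℝ E]
    (G : ℝ → E → E) (hG : Continuous (fun p : ℝ × E => G p.1 p.2)) (C : ℝ)
    (hC : ∀ t x, ‖G t x‖ ≤ C) (b : ℝ) (y0 : E) :
    ∃ y : ℝ → E, y b = y0 ∧ 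
      ∀ t ∈ Icc b (b + 1), HasDerivWithinAt y (G t (y t)) (Icc b (b + 1)) t := by
  have : CompleteSpace E := FiniteDimensional.complete ℝ E
  have : ProperSpace E := FiniteDimensional.proper ℝ E
  have hC0 : 0 ≤ C := (norm_nonneg _).trans (hC 0 0)
  have H : ∀ n : ℕ, ∃ φ : ℝ → E, Continuous φ ∧ φ b = y0 ∧ (∀ s t, ‖φ s - φ t‖ ≤ C * |s - t|) ∧
      ∀ t ∈ Icc b (b + 1), HasDerivWithinAt φ (G t (φ (t - 1 / ((n : ℝ) + 1)))) (Icc b (b + 1)) t := by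
    intro n
    obtain ⟨φ, h1, h2, h3, h4⟩ := delay_approx G hG C hC b y0 (1 / ((n : ℝ) + 1)) (n + 1)
    refine ⟨φ, h1, h2 b le_rfl, h3, ?_⟩
    intro t ht
    have hcont : Continuous (fun u => G u (φ (u - 1 / ((n : ℝ) + 1)))) :=
      hG.comp (continuous_id.prodMk (h1.comp (continuous_id.sub continuous_const)))
    have e : ((n + 1 : ℕ) : ℝ) * (1 / ((n : ℝ) + 1)) = 1 := by push_cast; field_simp
    rw [e] at h4
    have hd := ((hcont.integral_hasStrictDerivAt b t).hasDerivAt.const_add y0).hasDerivWithinAt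
      (s := Icc b (b + 1))
    exact hd.congr h4 (h4 t ht)
  choose φ hφc hφb hφl hφd using H
  let 𝓤 : Ultrafilter ℕ := hyperfilter ℕ
  have hlim : ∀ t, ∃ z, Tendsto (fun n => φ n t) 𝓤 (𝓝 z) := by
    intro t
    obtain ⟨z, -, hz⟩ := (isCompact_closedBall y0 (C * |t - b|)).ultrafilter_le_nhds
      (𝓤.map (fun n => φ n t)) (by
        rw [le_principal_iff]
        refine Filter.mem_map.2 (Filter.univ_mem' fun n => ?_)
        have := hφl n t b
        rw [hφb] at this
        simpa [dist_eq_norm] using this)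
    exact ⟨z, hz⟩
  choose y hy using hlim
  have hyl : ∀ s t, ‖y s - y t‖ ≤ C * |s - t| := by
    intro s t
    exact le_of_tendsto ((hy s).sub (hy t)).norm (Eventually.of_forall fun n => hφl n s t)
  refine ⟨y, ?_, ?_⟩
  · have h1 : Tendsto (fun n => φ n b) 𝓤 (𝓝 y0) := by
      simp only [hφb]; exact tendsto_const_nhds
    exact tendsto_nhds_unique (hy b) h1
  intro t ht
  rw [hasDerivWithinAt_iff_isLittleO, Asymptotics.isLittleO_iff]
  intro ε hε
  obtain ⟨δ, hδ, hGδ⟩ := Metric.continuousAt_iff.1 (hG.continuousAt (x := (t, y t))) ε hε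
  -- choose the neighbourhood
  obtain ⟨η, hη, hηδ⟩ : ∃ η > 0, η < δ ∧ C * (η + η) + η < δ := by
    refine ⟨δ / (2 * (2 * C + 1)), by positivity, ?_, ?_⟩
    · rw [div_lt_iff₀ (by positivity)]; nlinarith
    · have : C * (δ / (2 * (2 * C + 1)) + δ / (2 * (2 * C + 1))) + δ / (2 * (2 * C + 1)) = δ / 2 := by
        field_simp; ring
      linarith
  have hev : ∀ᶠ n : ℕ in (𝓤 : Filter ℕ), 1 / ((n : ℝ) + 1) < η := by
    have h1 : ∀ᶠ n : ℕ in atTop, 1 / ((n : ℝ) + 1) < η :=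
      (tendsto_one_div_add_atTop_nhds_zero_nat (𝕜 := ℝ)).eventually (gt_mem_nhds hη)
    exact (Nat.hyperfilter_le_atTop) h1
  have hev2 : ∀ᶠ n : ℕ in (𝓤 : Filter ℕ), dist (φ n t) (y t) < η :=
    (hy t).eventually (Metric.ball_mem_nhds _ hη)
  have hmem : Metric.ball t η ∩ Icc b (b + 1) ∈ 𝓝[Icc b (b + 1)] t :=
    inter_mem (mem_nhdsWithin_of_mem_nhds (Metric.ball_mem_nhds _ hη)) self_mem_nhdsWithin
  filter_upwards [hmem] with s hs
  have hconv : Convex ℝ (Metric.ball t η ∩ Icc b (b + 1)) :=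
    (convex_ball t η).inter (convex_Icc _ _)
  refine le_of_tendsto (((hy s).sub (hy t)).sub_const _).norm ?_
  filter_upwards [hev, hev2] with n hn1 hn2
  have key := Convex.norm_image_sub_le_of_norm_hasDerivWithin_le (𝕜 := ℝ)
    (f := fun u => φ n u - (u - t) • G t (y t))
    (f' := fun u => G u (φ n (u - 1 / ((n : ℝ) + 1))) - G t (y t))
    (s := Metric.ball t η ∩ Icc b (b + 1)) (x := t) (y := s) (C := ε) ?_ ?_ hconv
    ⟨Metric.mem_ball_self hη, ht⟩ hs
  · simp only [sub_self, zero_smul, sub_zero] at key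
    exact le_of_eq_of_le (congrArg norm (sub_right_comm _ _ _)) key
  · intro u hu
    have h1 := (hφd n u hu.2).mono (inter_subset_right (s := Metric.ball t η))
    have h2 : HasDerivWithinAt (fun u => (u - t) • G t (y t)) ((1 : ℝ) • G t (y t))
        (Metric.ball t η ∩ Icc b (b + 1)) u :=
      ((hasDerivWithinAt_id u _).sub_const t).smul_const _
    rw [one_smul] at h2
    exact h1.sub h2
  · intro u hu
    rw [← dist_eq_norm]
    have hut : |u - t| < η := by simpa [Real.dist_eq] using hu.1
    refine (hGδ (x := (u, φ n (u - 1 / ((n : ℝ) + 1)))) ?_).le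
    rw [Prod.dist_eq, max_lt_iff]
    refine ⟨?_, ?_⟩
    · simp only [Real.dist_eq]; linarith [hηδ.1]
    · have h1 := hφl n (u - 1 / ((n : ℝ) + 1)) t
      have hn : (0 : ℝ) < 1 / ((n : ℝ) + 1) := Nat.one_div_pos_of_nat
      have h2 : |u - 1 / ((n : ℝ) + 1) - t| ≤ η + η := by
        rw [abs_le]; rw [abs_lt] at hut; constructor <;> linarith [hut.1, hut.2]
      have h3 := mul_le_mul_of_nonneg_left h2 hC0
      have h4 := dist_triangle (φ n (u - 1 / ((n : ℝ) + 1))) (φ n t) (y t)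
      rw [← dist_eq_norm] at h1
      simp only
      linarith [hηδ.2]

theorem peano_local {E : Type*} [NormedAddCommGroup E] [NormedSpace ℝ E] [FiniteDimensional ℝ E]
    (F : ℝ → E → E) (p : E) (δ : ℝ) (hδ : 0 < δ)
    (hF : ContinuousOn (fun q : ℝ × E => F q.1 q.2) (Ioi 0 ×ˢ Metric.closedBall p δ)) (C b : ℝ)
    (hb : 0 < b) (hC : ∀ t ≥ b, ∀ x ∈ Metric.closedBall p δ, ‖F t x‖ ≤ C) (y0 : E)
    (hy0 : y0 ∈ Metric.ball p δ) :
    ∃ (y : ℝ → E) (ε : ℝ), 0 < ε ∧ y b = y0 ∧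
      ∀ t ∈ Icc b (b + ε), y t ∈ Metric.closedBall p δ ∧
        HasDerivWithinAt y (F t (y t)) (Icc b (b + ε)) t := by
  let ρ : E → E := fun x => p + (δ / max δ ‖x - p‖) • (x - p)
  have hm : ∀ x, 0 < max δ ‖x - p‖ := fun x => lt_max_of_lt_left hδ
  have hρc : Continuous ρ := by
    refine continuous_const.add (Continuous.smul ?_ (continuous_id.sub continuous_const))
    exact continuous_const.div (continuous_const.max (continuous_id.sub continuous_const).norm)
      (fun x => (hm x).ne')
  have hρm : ∀ x, ρ x ∈ Metric.closedBall p δ := by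
    intro x
    simp only [ρ, mem_closedBall_iff_norm, add_sub_cancel_left, norm_smul, norm_div,
      Real.norm_eq_abs, abs_of_pos hδ, abs_of_pos (hm x)]
    rw [div_mul_eq_mul_div, div_le_iff₀ (hm x)]
    exact mul_le_mul_of_nonneg_left (le_max_right _ _) hδ.le
  have hρid : ∀ x ∈ Metric.closedBall p δ, ρ x = x := by
    intro x hx
    rw [mem_closedBall_iff_norm] at hx
    simp [ρ, max_eq_left hx, hδ.ne']
  obtain ⟨y, hyb, hyd⟩ := peano (fun t x => F (max t b) (ρ x)) (by
      refine hF.comp_continuous (f := fun q : ℝ × E => (max q.1 b, ρ q.2)) ?_ ?_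
      · exact (continuous_fst.max continuous_const).prodMk (hρc.comp continuous_snd)
      · intro q
        exact ⟨lt_max_of_lt_right hb, hρm _⟩) C
      (fun t x => hC _ (le_max_right _ _) _ (hρm x)) b y0
  have hcont : ContinuousWithinAt y (Icc b (b + 1)) b :=
    (hyd b ⟨le_rfl, by linarith⟩).continuousWithinAt
  have hev : ∀ᶠ t in 𝓝[Icc b (b + 1)] b, y t ∈ Metric.ball p δ :=
    hcont (by rw [hyb]; exact Metric.isOpen_ball.mem_nhds hy0)
  rw [eventually_nhdsWithin_iff, Metric.eventually_nhds_iff] at hev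
  obtain ⟨η, hη, hη'⟩ := hev
  refine ⟨y, min (η / 2) 1, by positivity, hyb, ?_⟩
  intro t ht
  have h1 : min (η / 2) 1 ≤ η / 2 := min_le_left _ _
  have h2 : min (η / 2) 1 ≤ 1 := min_le_right _ _
  have ht1 : t ∈ Icc b (b + 1) := ⟨ht.1, by linarith [ht.2]⟩
  have hyt : y t ∈ Metric.closedBall p δ := by
    apply Metric.ball_subset_closedBall
    refine hη' ?_ ht1
    rw [Real.dist_eq, abs_of_nonneg (by linarith [ht.1])]
    linarith [ht.2]
  refine ⟨hyt, ?_⟩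
  have := hyd t ht1
  simp only [max_eq_left ht.1, hρid _ hyt] at this
  exact this.mono (Icc_subset_Icc le_rfl (by linarith))

theorem glue {E : Type*} [NormedAddCommGroup E] [NormedSpace ℝ E]
    (F : ℝ → E → E) (U : Set E) (x y : ℝ → E) (s b ε : ℝ) (hsb : s ≤ b) (hε : 0 < ε)
    (hx : ∀ t ∈ Icc s b, x t ∈ U ∧ HasDerivWithinAt x (F t (x t)) (Icc s b) t)
    (hy : ∀ t ∈ Icc b (b + ε), y t ∈ U ∧ HasDerivWithinAt y (F t (y t)) (Icc b (b + ε)) t)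
    (hxy : y b = x b) :
    ∃ z : ℝ → E, EqOn x z (Icc s b) ∧
      ∀ t ∈ Icc s (b + ε), z t ∈ U ∧ HasDerivWithinAt z (F t (z t)) (Icc s (b + ε)) t := by
  let z : ℝ → E := fun t => if t ≤ b then x t else y t
  have hz1 : ∀ t ∈ Icc s b, z t = x t := fun t ht => if_pos ht.2
  have hz2 : ∀ t ∈ Icc b (b + ε), z t = y t := by
    intro t ht
    rcases ht.1.eq_or_lt with h | h
    · subst h; simp [z, hxy]
    · exact if_neg h.not_ge
  have hun : Icc s (b + ε) = Icc s b ∪ Icc b (b + ε) :=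
    (Icc_union_Icc_eq_Icc hsb (by linarith)).symm
  refine ⟨z, fun t ht => (hz1 t ht).symm, ?_⟩
  intro t ht
  rw [hun] at ht ⊢
  refine ⟨?_, ?_⟩
  · rcases ht with h | h
    · rw [hz1 t h]; exact (hx t h).1
    · rw [hz2 t h]; exact (hy t h).1
  · apply HasDerivWithinAt.union
    · by_cases h : t ∈ Icc s b
      · rw [hz1 t h]
        exact (hx t h).2.congr hz1 (hz1 t h)
      · exact HasFDerivWithinAt.of_notMem_closure (by rwa [isClosed_Icc.closure_eq])
    · by_cases h : t ∈ Icc b (b + ε)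
      · rw [hz2 t h]
        exact (hy t h).2.congr hz2 (hz2 t h)
      · exact HasFDerivWithinAt.of_notMem_closure (by rwa [isClosed_Icc.closure_eq])

theorem interval_shape (J : Set ℝ) (s : ℝ) (hs : s ∈ J) (hJ : J ⊆ Ici s) (hoc : J.OrdConnected)
    (hne : J ≠ Ici s) : ∃ b, s ≤ b ∧ (J = Icc s b ∨ (s < b ∧ J = Ico s b)) := by
  have hbdd : BddAbove J := by
    by_contra h
    apply hne
    apply hJ.antisymm
    intro t ht
    rw [not_bddAbove_iff] at h
    obtain ⟨u, hu, htu⟩ := h t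
    exact hoc.out hs hu ⟨ht, htu.le⟩
  have hle : ∀ t ∈ J, t ≤ sSup J := fun t ht => le_csSup hbdd ht
  have hlt : ∀ t, s ≤ t → t < sSup J → t ∈ J := by
    intro t h1 h2
    obtain ⟨u, hu, htu⟩ := exists_lt_of_lt_csSup ⟨s, hs⟩ h2
    exact hoc.out hs hu ⟨h1, htu.le⟩
  refine ⟨sSup J, hle s hs, ?_⟩
  by_cases hb : sSup J ∈ J
  · left
    apply Subset.antisymm
    · exact fun t ht => ⟨hJ ht, hle t ht⟩
    · exact hoc.out hs hb
  · right
    have hne' : ∀ t ∈ J, t < sSup J := fun t ht => (hle t ht).lt_of_ne (fun h => hb (h ▸ ht))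
    refine ⟨hne' s hs, Subset.antisymm (fun t ht => ⟨hJ ht, hne' t ht⟩) 
      (fun t ht => hlt t ht.1 ht.2)⟩

/-- extension to the right endpoint -/
theorem extend_end {m : ℕ} (F : ℝ → (Fin m → ℝ) → (Fin m → ℝ)) (K : Set (Fin m → ℝ))
    (hK : IsClosed K)
    (hF : ContinuousOn (fun q : ℝ × (Fin m → ℝ) => F q.1 q.2) (Ioi 0 ×ˢ K)) (C s b : ℝ)
    (hs : 0 < s) (hsb : s < b)
    (hC : ∀ t ≥ s, ∀ x ∈ K, ‖F t x‖ ≤ C) (x : ℝ → (Fin m → ℝ))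
    (hx : ∀ t ∈ Ico s b, x t ∈ K ∧ HasDerivWithinAt x (F t (x t)) (Ico s b) t) :
    ∃ z : ℝ → (Fin m → ℝ), EqOn x z (Ico s b) ∧
      ∀ t ∈ Icc s b, z t ∈ K ∧ HasDerivWithinAt z (F t (z t)) (Icc s b) t := by
  have hC0 : 0 ≤ C := (norm_nonneg _).trans (hC s le_rfl (x s) (hx s ⟨le_rfl, hsb⟩).1)
  have hlip : LipschitzOnWith ⟨C, hC0⟩ x (Ico s b) :=
    (convex_Ico s b).lipschitzOnWith_of_nnnorm_hasDerivWithin_le (fun t ht => (hx t ht).2)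
      (fun t ht => hC t ht.1 _ (hx t ht).1)
  obtain ⟨z, hz, hxz⟩ := hlip.extend_pi
  have hzc : Continuous z := hz.continuous
  have hzd : ∀ t ∈ Ico s b, HasDerivWithinAt z (F t (z t)) (Ico s b) t := by
    intro t ht
    rw [← hxz ht]
    exact (hx t ht).2.congr (fun u hu => (hxz hu).symm) (hxz ht).symm
  have hzK' : ∀ t ∈ Ico s b, z t ∈ K := fun t ht => by rw [← hxz ht]; exact (hx t ht).1
  have hcl : ∀ t ∈ Icc s b, z t ∈ K := by
    intro t ht
    rw [← closure_Ico hsb.ne] at ht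
    exact hK.closure_subset (map_mem_closure hzc ht hzK')
  have hda : ∀ t ∈ Ioo s b, HasDerivAt z (F t (z t)) t := fun t ht =>
    (hzd t ⟨ht.1.le, ht.2⟩).hasDerivAt (Ico_mem_nhds ht.1 ht.2)
  refine ⟨z, hxz, fun t ht => ⟨hcl t ht, ?_⟩⟩
  rcases ht.2.eq_or_lt with h | h
  · subst h
    refine (hasDerivWithinAt_Iic_of_tendsto_deriv (s := Ioo s t)
      (fun u hu => (hda u hu).differentiableAt.differentiableWithinAt)
      hzc.continuousWithinAt (Ioo_mem_nhdsLT hsb) ?_).mono Icc_subset_Iic_self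
    have h1 : ContinuousWithinAt (fun u => F u (z u)) (Icc s t) t := by
      have : ContinuousOn (fun u => F u (z u)) (Icc s t) :=
        hF.comp (f := fun u => (u, z u)) (continuous_id.prodMk hzc).continuousOn
          (fun u hu => ⟨lt_of_lt_of_le hs hu.1, hcl u hu⟩)
      exact this t ht
    have h2 : Tendsto (fun u => F u (z u)) (𝓝[<] t) (𝓝 (F t (z t))) := by
      refine h1.mono_left ?_
      rw [nhdsWithin_le_iff]
      exact mem_of_superset (Ioo_mem_nhdsLT hsb) Ioo_subset_Icc_self
    refine h2.congr' ?_
    filter_upwards [Ioo_mem_nhdsLT hsb] with u hu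
    exact (hda u hu).deriv.symm
  · refine (hzd t ⟨ht.1, h⟩).mono_of_mem_nhdsWithin ?_
    have : Iio b ∩ Icc s b ∈ 𝓝[Icc s b] t :=
      inter_mem (mem_nhdsWithin_of_mem_nhds (Iio_mem_nhds h)) self_mem_nhdsWithin
    exact mem_of_superset this (fun u hu => ⟨hu.2.1, hu.1⟩)

/-- scalar decay -/
theorem decay (q q' : ℝ → ℝ) (s c K : ℝ) (hc : 0 < c) 
    (hq : ∀ t ≥ s, 0 ≤ q t) (hd : ∀ t > s, HasDerivAt q (q' t) t)
    (hle : ∀ t > s, q' t ≤ -c * q t + K / t) : Tendsto q atTop (𝓝 0) := by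
  rw [Metric.tendsto_atTop]
  intro ε hε
  have h1 : Tendsto (fun t : ℝ => K / t) atTop (𝓝 0) := tendsto_const_nhds.div_atTop tendsto_id
  have h2 : ∀ᶠ t in atTop, K / t < c * (ε / 2) := h1.eventually (gt_mem_nhds (by positivity))
  obtain ⟨S0, hS0⟩ := eventually_atTop.1 h2
  set S := max S0 (s + 1) with hS
  have hSs : s < S := lt_of_lt_of_le (by linarith) (le_max_right _ _)
  have hS' : S0 ≤ S := le_max_left _ _
  have hD : ∀ t ≥ S, HasDerivAt (fun t => (q t - ε / 2) * Real.exp (c * t))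
      (q' t * Real.exp (c * t) + (q t - ε / 2) * (Real.exp (c * t) * (c * 1))) t := by
    intro t ht
    exact ((hd t (by linarith)).sub_const _).mul (((hasDerivAt_id t).const_mul c).exp)
  have hanti : AntitoneOn (fun t => (q t - ε / 2) * Real.exp (c * t)) (Ici S) := by
    apply antitoneOn_of_deriv_nonpos (convex_Ici S)
    · exact fun t ht => (hD t ht).continuousAt.continuousWithinAt
    · intro t ht
      exact (hD t (interior_subset ht)).differentiableAt.differentiableWithinAt
    · intro t ht
      have ht' : S ≤ t := interior_subset ht
      rw [(hD t ht').deriv]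
      have e1 := hle t (by linarith)
      have e2 := hS0 t (by linarith)
      have e3 : 0 < Real.exp (c * t) := Real.exp_pos _
      have e4 : q' t + (q t - ε / 2) * c ≤ 0 := by nlinarith
      nlinarith
  have h3 : Tendsto (fun t => (q S - ε / 2) * Real.exp (c * S) * Real.exp (-(c * t))) atTop (𝓝 0) := by
    have : Tendsto (fun t => Real.exp (-(c * t))) atTop (𝓝 0) :=
      Real.tendsto_exp_neg_atTop_nhds_zero.comp (tendsto_id.const_mul_atTop hc)
    simpa using this.const_mul ((q S - ε / 2) * Real.exp (c * S))
  obtain ⟨N, hN⟩ := eventually_atTop.1 (h3.eventually (gt_mem_nhds (show 0 < ε / 2 by positivity)))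
  refine ⟨max N S, fun t ht => ?_⟩
  have htN := le_of_max_le_left ht
  have htS := le_of_max_le_right ht
  have h4 := hanti (mem_Ici.2 le_rfl) (mem_Ici.2 htS) htS
  simp only at h4
  have h5 := mul_le_mul_of_nonneg_right h4 (Real.exp_pos (-(c * t))).le
  rw [mul_assoc, ← Real.exp_add, add_neg_cancel, Real.exp_zero, mul_one] at h5
  have h6 := hN t htN
  have h7 := hq t (by linarith)
  rw [Real.dist_eq, sub_zero, abs_of_nonneg h7]
  linarith


/-- **Stability theorem** (Theorem 1 of the paper, cf. Theorem 4.5 in Brauer–Nohel).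
Let `U ⊆ ℝ^m` be open, `X : U → ℝ^m` continuously differentiable, and `x* ∈ U` with
`X(x*) = 0` such that every complex eigenvalue of the linearization `DX(x*)` has negative
real part.  Let `Y : (0,∞) × U → ℝ^m` be bounded and continuous.  Then there exist
`s₁ > 0` and an open set `V ⊆ U` containing `x*` such that for every `s₀ > s₁` and
every `x₀ ∈ V`, any maximally extended solution of
`dx/ds = X(x) + (1/s) Y(s,x)`, `x(s₀) = x₀`, exists for all `s ≥ s₀` and converges
to `x*` as `s → ∞`.  Here a maximally extended solution is a solution, defined on an
interval `J ⊆ [s₀,∞)` containing `s₀`, which admits no proper extension. -/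
theorem stmt_0 {m : ℕ}
    (U : Set (Fin m → ℝ)) (hU : IsOpen U)
    (X : (Fin m → ℝ) → (Fin m → ℝ)) (hX : ContDiffOn ℝ 1 X U)
    (xstar : Fin m → ℝ) (hxstarU : xstar ∈ U) (hXzero : X xstar = 0)
    (hEig : ∀ z : ℂ,
      (((LinearMap.toMatrix' ((fderiv ℝ X xstar : (Fin m → ℝ) →L[ℝ] (Fin m → ℝ)) :
          (Fin m → ℝ) →ₗ[ℝ] (Fin m → ℝ))).map Complex.ofReal).charpoly).IsRoot z →
        z.re < 0)
    (Y : ℝ → (Fin m → ℝ) → (Fin m → ℝ))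
    (hYcont : ContinuousOn (fun p : ℝ × (Fin m → ℝ) => Y p.1 p.2) (Ioi 0 ×ˢ U))
    (hYbdd : ∃ M : ℝ, ∀ s ∈ Ioi (0:ℝ), ∀ y ∈ U, ‖Y s y‖ ≤ M) :
    ∃ s₁ > (0:ℝ), ∃ V : Set (Fin m → ℝ),
      IsOpen V ∧ V ⊆ U ∧ xstar ∈ V ∧
      ∀ s₀ > s₁, ∀ x₀ ∈ V,
        ∀ (x : ℝ → (Fin m → ℝ)) (J : Set ℝ),
          -- `x` is a solution on the interval `J ⊆ [s₀, ∞)` containing `s₀` ...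
          s₀ ∈ J → J ⊆ Ici s₀ → J.OrdConnected →
          (∀ t ∈ J, x t ∈ U ∧
            HasDerivWithinAt x (X (x t) + (1 / t) • Y t (x t)) J t) →
          -- ... which is maximally extended ...
          (∀ (y : ℝ → (Fin m → ℝ)) (J' : Set ℝ),
            J ⊆ J' → J' ⊆ Ici s₀ → J'.OrdConnected →
            (∀ t ∈ J', y t ∈ U ∧
              HasDerivWithinAt y (X (y t) + (1 / t) • Y t (y t)) J' t) →
            EqOn x y J → J' = J) →
          -- ... with the prescribed initial condition
          x s₀ = x₀ →
          J = Ici s₀ ∧ Tendsto x atTop (𝓝 xstar) := by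
  obtain ⟨M, hM⟩ := hYbdd
  have hM0 : 0 ≤ M := (norm_nonneg _).trans (hM 1 (mem_Ioi.2 one_pos) xstar hxstarU)
  obtain ⟨H, _, _, L, c, a, hc, ha, hLa, hLc⟩ := lyap_real (fderiv ℝ X xstar) hEig
  have hXd : HasFDerivAt X (fderiv ℝ X xstar) xstar :=
    ((hX.differentiableOn one_ne_zero).differentiableAt (hU.mem_nhds hxstarU)).hasFDerivAt
  set A := fderiv ℝ X xstar with hA
  -- the remainder estimate
  obtain ⟨η, hη, hηc⟩ : ∃ η > 0, ‖L‖ * η * a ≤ c / 2 := by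
    refine ⟨c / (2 * (‖L‖ + 1) * a), by positivity, ?_⟩
    have : ‖L‖ * (c / (2 * (‖L‖ + 1) * a)) * a = (‖L‖ / (‖L‖ + 1)) * (c / 2) := by field_simp
    rw [this]
    have h1 : ‖L‖ / (‖L‖ + 1) ≤ 1 := by
      rw [div_le_one (by positivity)]; linarith
    nlinarith
  have hrem : ∀ᶠ x in 𝓝 xstar, ‖X x - X xstar - A (x - xstar)‖ ≤ η * ‖x - xstar‖ :=
    (hasFDerivAt_iff_isLittleO.1 hXd).def hη
  obtain ⟨δ, hδ, hδ'⟩ := Metric.nhds_basis_closedBall.mem_iff.1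
    (Filter.inter_mem (hU.mem_nhds hxstarU) hrem)
  have hδU : Metric.closedBall xstar δ ⊆ U := fun x hx => (hδ' hx).1
  have hδr : ∀ x ∈ Metric.closedBall xstar δ,
      ‖X x - A (x - xstar)‖ ≤ η * ‖x - xstar‖ := by
    intro x hx
    have : ‖X x - X xstar - A (x - xstar)‖ ≤ η * ‖x - xstar‖ := (hδ' hx).2
    rwa [hXzero, sub_zero] at this
  set F : ℝ → (Fin m → ℝ) → (Fin m → ℝ) := fun t x => X x + (1 / t) • Y t x with hFdef
  set K : ℝ := 2 * (‖L‖ * δ * ‖L‖ * M) with hKdef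
  have hK0 : 0 ≤ K := by positivity
  have hvf : ∀ t > 0, ∀ x ∈ Metric.closedBall xstar δ,
      2 * inner ℝ (L (x - xstar)) (L (F t x)) ≤ -c * ‖L (x - xstar)‖ ^ 2 + K / t := by
    intro t ht x hx
    have hxn : ‖x - xstar‖ ≤ δ := by rwa [mem_closedBall_iff_norm] at hx
    set z := x - xstar with hz
    have e : F t x = A z + (X x - A z) + (1 / t) • Y t x := by simp [hFdef]
    rw [e, map_add, map_add, inner_add_right, inner_add_right]
    have h1 := hLc z
    have h2 : inner ℝ (L z) (L (X x - A z)) ≤ c / 2 * ‖L z‖ ^ 2 := by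
      calc inner ℝ (L z) (L (X x - A z)) ≤ ‖L z‖ * ‖L (X x - A z)‖ := real_inner_le_norm _ _
        _ ≤ ‖L z‖ * (‖L‖ * (η * (a * ‖L z‖))) := by
          gcongr
          refine (L.le_opNorm _).trans ?_
          gcongr
          refine (hδr x hx).trans ?_
          gcongr
          exact hLa z
        _ = (‖L‖ * η * a) * ‖L z‖ ^ 2 := by ring
        _ ≤ _ := by gcongr
    have h3 : inner ℝ (L z) (L ((1 / t) • Y t x)) ≤ K / t / 2 := by
      calc inner ℝ (L z) (L ((1 / t) • Y t x)) ≤ ‖L z‖ * ‖L ((1 / t) • Y t x)‖ :=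
            real_inner_le_norm _ _
        _ ≤ (‖L‖ * δ) * (‖L‖ * (1 / t * M)) := by
          gcongr
          · refine (L.le_opNorm _).trans ?_
            gcongr
          · refine (L.le_opNorm _).trans ?_
            gcongr
            rw [norm_smul, Real.norm_eq_abs, abs_of_pos (by positivity)]
            gcongr
            exact hM t ht x (hδU hx)
        _ = K / t / 2 := by rw [hKdef]; field_simp
    linarith
  have hFc : ContinuousOn (fun q : ℝ × (Fin m → ℝ) => F q.1 q.2)
      (Ioi 0 ×ˢ Metric.closedBall xstar δ) := by
    have h0 : ContinuousOn (fun q : ℝ × (Fin m → ℝ) => F q.1 q.2) (Ioi 0 ×ˢ U) := by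
      refine ContinuousOn.add ?_ (ContinuousOn.smul (f := fun q : ℝ × (Fin m → ℝ) => 1 / q.1) ?_ hYcont)
      · exact hX.continuousOn.comp continuousOn_snd (fun q hq => hq.2)
      · exact continuousOn_const.div continuousOn_fst (fun q hq => (ne_of_gt hq.1))
    exact h0.mono (prod_mono le_rfl hδU)
  obtain ⟨CX, hCX⟩ := (isCompact_closedBall xstar δ).exists_bound_of_continuousOn
    (hX.continuousOn.mono hδU)
  have hFb : ∀ s > 0, ∀ t ≥ s, ∀ x ∈ Metric.closedBall xstar δ,
      ‖F t x‖ ≤ CX + 1 / s * M := by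
    intro s hs t ht x hx
    have ht0 : 0 < t := lt_of_lt_of_le hs ht
    refine (norm_add_le _ _).trans (add_le_add (hCX x hx) ?_)
    rw [norm_smul, Real.norm_eq_abs, abs_of_pos (by positivity)]
    gcongr
    exact hM t ht0 x (hδU hx)
  -- the trapping region
  set ρ : ℝ := δ / (2 * a) with hρ
  have hρ0 : 0 < ρ := by positivity
  have hin : ∀ x, ‖L (x - xstar)‖ ≤ ρ → x ∈ Metric.ball xstar δ := by
    intro x hx
    rw [mem_ball_iff_norm]
    have h1 := (hLa (x - xstar)).trans (mul_le_mul_of_nonneg_left hx ha.le)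
    have h2 : a * ρ = δ / 2 := by rw [hρ]; field_simp
    linarith
  have hcontL : Continuous (fun x => ‖L (x - xstar)‖) :=
    (L.continuous.comp (continuous_id.sub continuous_const)).norm
  refine ⟨K / (c * ρ ^ 2) + 1, by positivity, {x | ‖L (x - xstar)‖ < ρ},
    isOpen_lt hcontL continuous_const,
    fun x hx => hδU (Metric.ball_subset_closedBall (hin x (le_of_lt hx))), by simpa using hρ0, ?_⟩
  intro s₀ hs₀ x₀ hx₀ x J hsJ hJs hJ hsol hmax hstart
  have hs0 : 0 < s₀ := lt_trans (by positivity) hs₀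
  have hKs : ∀ t ≥ s₀, K / t < c * ρ ^ 2 := by
    intro t ht
    rw [div_lt_iff₀ (by linarith), mul_comm, ← div_lt_iff₀ (by positivity)]
    linarith
  have hqd : ∀ t ∈ J, HasDerivWithinAt (fun u => ‖L (x u - xstar)‖ ^ 2)
      (2 * inner ℝ (L (x t - xstar)) (L (F t (x t)))) J t := by
    intro t ht
    have h1 : HasDerivWithinAt (fun u => L (x u - xstar)) (L (F t (x t))) J t :=
      L.hasFDerivAt.comp_hasDerivWithinAt t ((hsol t ht).2.sub_const xstar)
    exact h1.norm_sq
  have htrap : ∀ t ∈ J, ‖L (x t - xstar)‖ ≤ ρ := by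
    intro b hb
    have hsub : Icc s₀ b ⊆ J := hJ.out hsJ hb
    have hsq : ‖L (x b - xstar)‖ ^ 2 ≤ ρ ^ 2 := by
      refine image_le_of_deriv_right_lt_deriv_boundary
        (f := fun u => ‖L (x u - xstar)‖ ^ 2)
        (f' := fun t => 2 * inner ℝ (L (x t - xstar)) (L (F t (x t))))
        (a := s₀) (b := b) (B := fun _ => ρ ^ 2) (B' := fun _ => 0) ?_ ?_ ?_ ?_ ?_
        (right_mem_Icc.2 (hJs hb))
      · exact fun t ht => ((hqd t (hsub ht)).mono hsub).continuousWithinAt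
      · intro t ht
        have h1 := (hqd t (hsub ⟨ht.1, ht.2.le⟩)).mono
          ((Icc_subset_Icc_left ht.1).trans hsub)
        exact h1.mono_of_mem_nhdsWithin (Icc_mem_nhdsGE ht.2)
      · have : ‖L (x s₀ - xstar)‖ < ρ := by rw [hstart]; exact hx₀
        gcongr
      · exact fun t => hasDerivAt_const t _
      · intro t ht hteq
        have h1 : ‖L (x t - xstar)‖ ≤ ρ := le_of_sq_le_sq hteq.le hρ0.le
        have h2 := hvf t (lt_of_lt_of_le hs0 ht.1) (x t) (Metric.ball_subset_closedBall (hin _ h1))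
        have h3 := hKs t ht.1
        rw [hteq] at h2
        linarith
    exact le_of_sq_le_sq hsq hρ0.le
  have hJeq : J = Ici s₀ := by
    by_contra hne
    obtain ⟨b, hsb, h | ⟨hsb', h⟩⟩ := interval_shape J s₀ hsJ hJs hJ hne
    · have hbJ : b ∈ J := by rw [h]; exact right_mem_Icc.2 hsb
      have hb0 : 0 < b := lt_of_lt_of_le hs0 hsb
      obtain ⟨y, ε, hε, hyb, hy⟩ := peano_local F xstar δ hδ hFc _ b hb0 (hFb b hb0) (x b)
        (hin _ (htrap b hbJ))
      obtain ⟨z, hz1, hz2⟩ := glue F U x y s₀ b ε hsb hε (by rw [← h]; exact hsol)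
        (fun t ht => ⟨hδU (hy t ht).1, (hy t ht).2⟩) hyb
      have := hmax z (Icc s₀ (b + ε)) (by rw [h]; exact Icc_subset_Icc_right (by linarith))
        Icc_subset_Ici_self ordConnected_Icc hz2 (by rw [h]; exact hz1)
      have hmem : b + ε ∈ J := by rw [← this]; exact right_mem_Icc.2 (by linarith)
      rw [h] at hmem
      linarith [hmem.2]
    · obtain ⟨z, hz1, hz2⟩ := extend_end F (Metric.closedBall xstar δ) Metric.isClosed_closedBall
        hFc _ s₀ b hs0 hsb' (hFb s₀ hs0) x (by
          rw [← h]
          exact fun t ht => ⟨Metric.ball_subset_closedBall (hin _ (htrap t ht)), (hsol t ht).2⟩)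
      have := hmax z (Icc s₀ b) (by rw [h]; exact Ico_subset_Icc_self)
        Icc_subset_Ici_self ordConnected_Icc (fun t ht => ⟨hδU (hz2 t ht).1, (hz2 t ht).2⟩)
        (by rw [h]; exact hz1)
      have hmem : b ∈ J := by rw [← this]; exact right_mem_Icc.2 hsb
      rw [h] at hmem
      exact lt_irrefl _ hmem.2
  refine ⟨hJeq, ?_⟩
  have hq0 : Tendsto (fun u => ‖L (x u - xstar)‖ ^ 2) atTop (𝓝 0) := by
    refine decay _ (fun t => 2 * inner ℝ (L (x t - xstar)) (L (F t (x t)))) s₀ c K hc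
      (fun t _ => sq_nonneg _) ?_ ?_
    · intro t ht
      refine (hqd t ?_).hasDerivAt ?_
      · rw [hJeq]; exact le_of_lt ht
      · rw [hJeq]; exact Ici_mem_nhds ht
    · intro t ht
      exact hvf t (lt_trans hs0 ht) (x t) (Metric.ball_subset_closedBall
        (hin _ (htrap t (by rw [hJeq]; exact le_of_lt ht))))
  have hn0 : Tendsto (fun u => a * ‖L (x u - xstar)‖) atTop (𝓝 0) := by
    have h1 := (hq0.sqrt).const_mul a
    simpa [Real.sqrt_sq] using h1
  rw [tendsto_iff_norm_sub_tendsto_zero]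
  exact squeeze_zero (fun _ => norm_nonneg _) (fun u => hLa _) hn0
end

section
/- Let β > 0, s₀ > 0, a ≥ 0, K > 0, S ≥ s₀, and let φ : [s₀,S] → ℝ be continuous and nonnegative such that φ(s) ≤ a + (β/2)∫_{s₀}^{s} ( φ(s') + (K/s') e^{β(s'-s₀)} ) ds' for all s ∈ [s₀,S]. Then for all s ∈ [s₀,S], e^{-β(s-s₀)} φ(s) ≤ a e^{-(β/2)(s-s₀)} + (βK/2) ∫_{s₀}^{s} (1/s') e^{-(β/2)(s-s')} ds'. -/
open Set

lemma prim_aux (u v : ℝ) (huv : u ≤ v) (f : ℝ → ℝ) (hf : ContinuousOn f (Icc u v)) :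
    ContinuousOn (fun x => ∫ t in u..x, f t) (Icc u v) ∧
    ∀ x ∈ Ioo u v, HasDerivAt (fun x => ∫ t in u..x, f t) (f x) x := by
  have hF : Continuous (IccExtend huv ((Icc u v).restrict f)) :=
    (continuousOn_iff_continuous_restrict.1 hf).Icc_extend'
  set F := IccExtend huv ((Icc u v).restrict f) with hFdef
  have hFf : ∀ x ∈ Icc u v, F x = f x := by
    intro x hx
    rw [hFdef, IccExtend_of_mem _ _ hx]; rfl
  have hd : ∀ x, HasDerivAt (fun x => ∫ t in u..x, F t) (F x) x := fun x =>
    intervalIntegral.integral_hasDerivAt_right (hF.intervalIntegrable _ _)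
      (hF.stronglyMeasurableAtFilter _ _) hF.continuousAt
  have he : ∀ x ∈ Icc u v, (∫ t in u..x, f t) = ∫ t in u..x, F t := by
    intro x hx
    apply intervalIntegral.integral_congr
    intro t ht
    rw [uIcc_of_le hx.1] at ht
    exact (hFf t ⟨ht.1, ht.2.trans hx.2⟩).symm
  refine ⟨?_, ?_⟩
  · refine ContinuousOn.congr (fun x _ => (hd x).continuousAt.continuousWithinAt) he
  · intro x hx
    rw [← hFf x ⟨hx.1.le, hx.2.le⟩]
    refine (hd x).congr_of_eventuallyEq ?_
    filter_upwards [Icc_mem_nhds hx.1 hx.2] with y hy using he y hy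

/-- The Gronwall-type estimate from Appendix A of the paper: if `φ` is continuous,
nonnegative, and satisfies
`φ(s) ≤ a + (β/2)∫_{s₀}^s (φ(s') + (K/s')·e^{β(s'-s₀)}) ds'` on `[s₀,S]`, then
`e^{-β(s-s₀)} φ(s) ≤ a e^{-(β/2)(s-s₀)} + (βK/2)∫_{s₀}^s (1/s')·e^{-(β/2)(s-s')} ds'`. -/
theorem stmt_1 (β s₀ a K S : ℝ) (hβ : 0 < β) (hs₀ : 0 < s₀) (ha : 0 ≤ a)
    (hK : 0 < K) (hS : s₀ ≤ S) (φ : ℝ → ℝ)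
    (hcont : ContinuousOn φ (Icc s₀ S))
    (hnonneg : ∀ s ∈ Icc s₀ S, 0 ≤ φ s)
    (hineq : ∀ s ∈ Icc s₀ S,
      φ s ≤ a + (β / 2) *
        ∫ s' in s₀..s, (φ s' + (K / s') * Real.exp (β * (s' - s₀)))) :
    ∀ s ∈ Icc s₀ S,
      Real.exp (-β * (s - s₀)) * φ s ≤
        a * Real.exp (-(β / 2) * (s - s₀)) +
          (β * K / 2) * ∫ s' in s₀..s, (1 / s') * Real.exp (-(β / 2) * (s - s')) := by
  have hne : ∀ x ∈ Icc s₀ S, x ≠ 0 := fun x hx => (hs₀.trans_le hx.1).ne'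
  have h1 : ContinuousOn (fun s' => φ s' + (K / s') * Real.exp (β * (s' - s₀))) (Icc s₀ S) := by
    refine hcont.add (ContinuousOn.mul (continuousOn_const.div continuousOn_id hne) ?_)
    fun_prop
  have h2 : ContinuousOn (fun s' => (1 / s') * Real.exp ((β / 2) * (s' - s₀))) (Icc s₀ S) := by
    refine ContinuousOn.mul (continuousOn_const.div continuousOn_id hne) ?_
    fun_prop
  obtain ⟨c1, d1⟩ := prim_aux s₀ S hS _ h1
  obtain ⟨c2, d2⟩ := prim_aux s₀ S hS _ h2
  set P : ℝ → ℝ := fun x => ∫ s' in s₀..x, (φ s' + (K / s') * Real.exp (β * (s' - s₀))) with hP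
  set Q : ℝ → ℝ := fun x => ∫ s' in s₀..x, (1 / s') * Real.exp ((β / 2) * (s' - s₀)) with hQ
  have hE : ∀ x, HasDerivAt (fun x => Real.exp (-(β / 2) * (x - s₀)))
      (Real.exp (-(β / 2) * (x - s₀)) * (-(β / 2))) x := by
    intro x
    have := (((hasDerivAt_id x).sub_const s₀).const_mul (-(β / 2))).exp
    simpa using this
  have hanti : AntitoneOn (fun x => Real.exp (-(β / 2) * (x - s₀)) * (a + (β / 2) * P x)
      - (β / 2 * K) * Q x) (Icc s₀ S) := by
    have hder : ∀ x ∈ Ioo s₀ S, HasDerivAt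
        (fun x => Real.exp (-(β / 2) * (x - s₀)) * (a + (β / 2) * P x) - (β / 2 * K) * Q x)
        _ x := fun x hx =>
      ((hE x).mul (((d1 x hx).const_mul (β / 2)).const_add a)).sub
        ((d2 x hx).const_mul (β / 2 * K))
    apply antitoneOn_of_deriv_nonpos (convex_Icc _ _)
    · refine ContinuousOn.sub (ContinuousOn.mul ?_ (continuousOn_const.add
        (continuousOn_const.mul c1))) (continuousOn_const.mul c2)
      fun_prop
    · rw [interior_Icc]
      exact fun x hx => (hder x hx).differentiableAt.differentiableWithinAt
    · rw [interior_Icc]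
      intro x hx
      rw [(hder x hx).deriv]
      have hi := hineq x ⟨hx.1.le, hx.2.le⟩
      change φ x ≤ a + (β / 2) * P x at hi
      have hexp : Real.exp ((β / 2) * (x - s₀)) =
          Real.exp (-(β / 2) * (x - s₀)) * Real.exp (β * (x - s₀)) := by
        rw [← Real.exp_add]; congr 1; ring
      rw [hexp]
      have := mul_nonneg (mul_nonneg (Real.exp_pos (-(β / 2) * (x - s₀))).le hβ.le)
        (sub_nonneg.2 hi)
      have e : K / x = K * (1 / x) := by ring
      rw [e]
      nlinarith [this]
  intro s hs
  have hm := hanti (left_mem_Icc.2 hS) hs hs.1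
  have hP0 : P s₀ = 0 := by simp [hP]
  have hQ0 : Q s₀ = 0 := by simp [hQ]
  simp only [hP0, hQ0, sub_self, mul_zero, Real.exp_zero, add_zero, one_mul, sub_zero] at hm
  have hi := hineq s hs
  change φ s ≤ a + (β / 2) * P s at hi
  have hQs : (∫ s' in s₀..s, (1 / s') * Real.exp (-(β / 2) * (s - s'))) =
      Real.exp (-(β / 2) * (s - s₀)) * Q s := by
    rw [hQ, ← intervalIntegral.integral_const_mul]
    congr 1
    funext t
    rw [mul_left_comm, ← Real.exp_add]
    congr 2; ring
  have hee : Real.exp (-β * (s - s₀)) =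
      Real.exp (-(β / 2) * (s - s₀)) * Real.exp (-(β / 2) * (s - s₀)) := by
    rw [← Real.exp_add]; congr 1; ring
  rw [hQs, hee]
  have hpos := (Real.exp_pos (-(β / 2) * (s - s₀))).le
  generalize Real.exp (-(β / 2) * (s - s₀)) = E at *
  have k1 := mul_le_mul_of_nonneg_left hi (mul_nonneg hpos hpos)
  have k2 := mul_le_mul_of_nonneg_left hm hpos
  linarith
end

section
/- Let A₀ > 0 and consider the vector field X(χ,Π) = A₀ χ³ ( χ(1 - χ/Π), (1 - Π²)(3χ - 2/Π) ) on the set {(χ,Π) ∈ ℝ² : χ > 0, Π ≠ 0}. Then X(χ,Π) = (0,0) holds exactly at the two points (χ₁,Π₁) = (1,1) and (χ₂,Π₂) = (√(2/3), √(2/3)). -/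
/-- For `A₀ > 0`, the vector field
`X(χ,Π) = A₀ χ³ (χ(1 - χ/Π), (1 - Π²)(3χ - 2/Π))` on `{χ > 0, Π ≠ 0}` vanishes
exactly at the two critical points `(1,1)` and `(√(2/3), √(2/3))`
(Eq. (DynSysInf) of the paper). -/
theorem stmt_5 (A₀ : ℝ) (hA₀ : 0 < A₀) :
    ∀ χ Pi : ℝ, 0 < χ → Pi ≠ 0 →
      ((A₀ * χ ^ 3 * (χ * (1 - χ / Pi)) = 0 ∧
        A₀ * χ ^ 3 * ((1 - Pi ^ 2) * (3 * χ - 2 / Pi)) = 0) ↔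
        ((χ, Pi) = (1, 1) ∨ (χ, Pi) = (Real.sqrt (2 / 3), Real.sqrt (2 / 3)))) := by
  intro χ Pi hχ hPi
  have hne : A₀ * χ ^ 3 ≠ 0 := by positivity
  simp only [Prod.mk.injEq]
  constructor
  · rintro ⟨h1, h2⟩
    have h1' : χ = Pi := by
      have h3 := (mul_eq_zero.mp ((mul_eq_zero.mp h1).resolve_left hne)).resolve_left hχ.ne'
      have h4 : χ / Pi = 1 := by linarith
      exact (div_eq_one_iff_eq hPi).mp h4
    subst h1'
    rcases mul_eq_zero.mp ((mul_eq_zero.mp h2).resolve_left hne) with h | h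
    · left
      have : χ = 1 := by nlinarith
      exact ⟨this, this⟩
    · right
      have h5 : χ ^ 2 = 2 / 3 := by
        field_simp at h
        linarith
      have : χ = Real.sqrt (2 / 3) := by
        rw [← h5, Real.sqrt_sq hχ.le]
      exact ⟨this, this⟩
  · rintro (⟨h1, h2⟩ | ⟨h1, h2⟩)
    · subst h1 h2
      norm_num
    · have h5 : χ ^ 2 = 2 / 3 := by
        rw [h1, Real.sq_sqrt (by norm_num)]
      have h6 : Pi = χ := by rw [h1, h2]
      subst h6
      have h7 : 3 * Pi - 2 / Pi = 0 := by
        field_simp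
        linarith
      rw [h7, div_self hPi]
      simp
end

section
/- Let A₀ > 0 and X(χ,Π) = A₀ χ³ ( χ(1 - χ/Π), (1 - Π²)(3χ - 2/Π) ) for χ > 0, Π ≠ 0. The Jacobian matrix of X at the critical point (1,1) equals A₀ · [[-1, 1], [0, -2]], and its eigenvalues are -A₀ and -2A₀, both of which are negative. -/
/-- For `A₀ > 0` and the vector field
`X(χ,Π) = A₀ χ³ (χ(1 - χ/Π), (1 - Π²)(3χ - 2/Π))` (χ > 0, Π ≠ 0), the Jacobian matrix
of `X` at the critical point `(1,1)` equals `A₀ · [[-1, 1], [0, -2]]`, and its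
eigenvalues are `-A₀` and `-2A₀`, both negative. -/
theorem stmt_6 (A₀ : ℝ) (hA₀ : 0 < A₀)
    (X : (Fin 2 → ℝ) → (Fin 2 → ℝ))
    (hX : X = fun v => ![A₀ * (v 0) ^ 3 * ((v 0) * (1 - v 0 / v 1)),
                         A₀ * (v 0) ^ 3 * ((1 - (v 1) ^ 2) * (3 * v 0 - 2 / v 1))]) :
    HasFDerivAt X
      (LinearMap.toContinuousLinearMap
        (Matrix.mulVecLin (A₀ • !![(-1 : ℝ), 1; 0, -2]))) ![1, 1] ∧
    spectrum ℝ (A₀ • !![(-1 : ℝ), 1; 0, -2]) = {-A₀, -2 * A₀} ∧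
    -A₀ < 0 ∧ -2 * A₀ < 0 := by
  refine ⟨?_, ?_, by linarith, by linarith⟩
  · subst hX
    have h0 : HasFDerivAt (fun v : Fin 2 → ℝ => v 0)
        (ContinuousLinearMap.proj (R := ℝ) (φ := fun _ : Fin 2 => ℝ) 0) ![1, 1] :=
      hasFDerivAt_apply 0 _
    have h1 : HasFDerivAt (fun v : Fin 2 → ℝ => v 1)
        (ContinuousLinearMap.proj (R := ℝ) (φ := fun _ : Fin 2 => ℝ) 1) ![1, 1] :=
      hasFDerivAt_apply 1 _
    have hi : HasFDerivAt (fun v : Fin 2 → ℝ => (v 1)⁻¹) _ ![1, 1] :=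
      HasDerivAt.comp_hasFDerivAt (f := fun v : Fin 2 → ℝ => v 1) (![1, 1] : Fin 2 → ℝ)
        (hasDerivAt_inv (x := (![1, 1] : Fin 2 → ℝ) 1) (by simp)) h1
    rw [hasFDerivAt_pi']
    intro i
    fin_cases i
    · have h := ((h0.pow 3).const_mul A₀).mul (h0.mul ((h0.mul hi).const_sub 1))
      refine (h.congr_fderiv ?_)
      ext v
      simp [Matrix.mulVec, dotProduct, Fin.sum_univ_two]
    · have h := ((h0.pow 3).const_mul A₀).mul
        (((h1.pow 2).const_sub 1).mul ((h0.const_mul 3).sub (hi.const_mul 2)))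
      refine (h.congr_fderiv ?_)
      ext v
      simp [Matrix.mulVec, dotProduct, Fin.sum_univ_two]
      ring
  · ext μ
    rw [spectrum.mem_iff, Matrix.isUnit_iff_isUnit_det, Matrix.det_fin_two, isUnit_iff_ne_zero,
      not_not]
    simp [Matrix.algebraMap_matrix_apply]
    constructor
    · rintro (h | h)
      · left; linarith
      · right; linarith
    · rintro (h | h)
      · left; linarith
      · right; linarith
end

section
/- Let A₀ > 0 and X(χ,Π) = A₀ χ³ ( χ(1 - χ/Π), (1 - Π²)(3χ - 2/Π) ) for χ > 0, Π ≠ 0. The Jacobian matrix of X at the critical point (√(2/3), √(2/3)) equals A₀ (2/3)^{3/2} · [[-1, 1], [1, 1]], and its eigenvalues are +√2 (2/3)^{3/2} A₀ and -√2 (2/3)^{3/2} A₀; in particular this critical point is hyperbolic, with one positive and one negative eigenvalue. -/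
/-- For `A₀ > 0` and the vector field
`X(χ,Π) = A₀ χ³ (χ(1 - χ/Π), (1 - Π²)(3χ - 2/Π))` (χ > 0, Π ≠ 0), the Jacobian matrix
of `X` at the critical point `(√(2/3), √(2/3))` equals `A₀ (2/3)^{3/2} · [[-1,1],[1,1]]`,
and its eigenvalues are `±√2 (2/3)^{3/2} A₀`; in particular this critical point is
hyperbolic, with one positive and one negative eigenvalue. -/
theorem stmt_7 (A₀ : ℝ) (hA₀ : 0 < A₀)
    (X : (Fin 2 → ℝ) → (Fin 2 → ℝ))
    (hX : X = fun v => ![A₀ * (v 0) ^ 3 * ((v 0) * (1 - v 0 / v 1)),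
                         A₀ * (v 0) ^ 3 * ((1 - (v 1) ^ 2) * (3 * v 0 - 2 / v 1))]) :
    HasFDerivAt X
      (LinearMap.toContinuousLinearMap
        (Matrix.mulVecLin ((A₀ * (2 / 3 : ℝ) ^ ((3 : ℝ) / 2)) • !![(-1 : ℝ), 1; 1, 1])))
      ![Real.sqrt (2 / 3), Real.sqrt (2 / 3)] ∧
    spectrum ℝ ((A₀ * (2 / 3 : ℝ) ^ ((3 : ℝ) / 2)) • !![(-1 : ℝ), 1; 1, 1]) =
      {Real.sqrt 2 * (2 / 3 : ℝ) ^ ((3 : ℝ) / 2) * A₀,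
       -(Real.sqrt 2 * (2 / 3 : ℝ) ^ ((3 : ℝ) / 2) * A₀)} ∧
    0 < Real.sqrt 2 * (2 / 3 : ℝ) ^ ((3 : ℝ) / 2) * A₀ ∧
    -(Real.sqrt 2 * (2 / 3 : ℝ) ^ ((3 : ℝ) / 2) * A₀) < 0 := by
  have hs : 0 < Real.sqrt (2 / 3) := Real.sqrt_pos.mpr (by norm_num)
  have hs2 : Real.sqrt (2 / 3) ^ 2 = 2 / 3 := Real.sq_sqrt (by norm_num)
  have hc : (2 / 3 : ℝ) ^ ((3 : ℝ) / 2) = Real.sqrt (2 / 3) ^ 3 := by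
    rw [Real.sqrt_eq_rpow, ← Real.rpow_natCast, ← Real.rpow_mul (by norm_num)]
    norm_num
  rw [hc]
  generalize Real.sqrt (2 / 3) = s at *
  have hpos : 0 < Real.sqrt 2 * s ^ 3 * A₀ := by positivity
  have ht2 : Real.sqrt 2 ^ 2 = 2 := Real.sq_sqrt (by norm_num)
  refine ⟨?_, ?_, hpos, by linarith⟩
  · have h0 : HasFDerivAt (fun v : Fin 2 → ℝ => v 0)
        (ContinuousLinearMap.proj (R := ℝ) (φ := fun _ : Fin 2 => ℝ) 0) ![s, s] :=
      hasFDerivAt_apply 0 _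
    have h1 : HasFDerivAt (fun v : Fin 2 → ℝ => v 1)
        (ContinuousLinearMap.proj (R := ℝ) (φ := fun _ : Fin 2 => ℝ) 1) ![s, s] :=
      hasFDerivAt_apply 1 _
    have hi : HasFDerivAt (fun v : Fin 2 → ℝ => (v 1)⁻¹)
        ((-(s ^ 2)⁻¹) • (ContinuousLinearMap.proj (R := ℝ) (φ := fun _ : Fin 2 => ℝ) 1))
        ![s, s] :=
      HasDerivAt.comp_hasFDerivAt (h₂ := fun y : ℝ => y⁻¹) (f := fun v : Fin 2 → ℝ => v 1)
        ![s, s] (hasDerivAt_inv hs.ne') h1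
    have hiv : s⁻¹ = 3 / 2 * s := by
      field_simp
      linarith
    rw [hX, hasFDerivAt_pi']
    intro i
    fin_cases i
    · have h := ((h0.pow 3).const_mul A₀).mul (h0.mul ((h0.mul hi).const_sub 1))
      refine HasFDerivAt.congr_fderiv h ?_
      ext v
      simp [dotProduct, Fin.sum_univ_two]
      field_simp
      ring
    · have h := ((h0.pow 3).const_mul A₀).mul
        (((h1.pow 2).const_sub 1).mul ((h0.const_mul 3).sub (hi.const_mul 2)))
      refine HasFDerivAt.congr_fderiv h ?_
      ext v
      simp [dotProduct, Fin.sum_univ_two]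
      rw [hs2, hiv]
      ring_nf
  · ext x
    rw [Matrix.mem_spectrum_iff_isRoot_charpoly, Matrix.charpoly_fin_two]
    simp only [Polynomial.IsRoot.def, Set.mem_insert_iff, Set.mem_singleton_iff]
    simp [Matrix.trace_fin_two, Matrix.det_fin_two]
    rw [← sub_eq_zero (a := x) (b := Real.sqrt 2 * s ^ 3 * A₀),
      ← add_eq_zero_iff_eq_neg, ← mul_eq_zero]
    have : (x - Real.sqrt 2 * s ^ 3 * A₀) * (x + Real.sqrt 2 * s ^ 3 * A₀)
      = x ^ 2 - 2 * (s ^ 3 * A₀) ^ 2 := by linear_combination (-(s ^ 3 * A₀) ^ 2) * ht2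
    rw [this]
    ring_nf
end

section
/- Let m₁ ≥ 0, r > 0, E₁ ∈ ℝ and b ≥ 0 satisfy 1 + 2E₁ > 0, 2m₁/r + 2E₁ ≥ 0, and 1 - (b²/r²)(1 - 2m₁/r) ≥ 0. Set p := √(1 + 2E₁), k := √(2m₁/r + 2E₁), Q := √(1 - (b²/r²)(1 - 2m₁/r)), D := r² + b²k², and define s := (b r / D)(p - k Q) and c := (1/D)(-b² k p - r² Q). Then s² + c² = 1; moreover, if p - kQ > 0, then p + k c > 0 and r s / (p + k c) = b. Hence the lower-sign formulas of Eqs. (sin_alpha_of_b)–(cos_alpha_of_b) define a genuine angle of incidence α with sin α = s, cos α = c, which inverts the relation b = r sin α / (√(1+2E₁) + √(2m₁/r + 2E₁) cos α). -/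
/-- Inversion of the impact-parameter relation, Eqs. (sin_alpha_of_b)–(cos_alpha_of_b)
of the paper (lower sign): with `p = √(1+2E₁)`, `k = √(2m₁/r + 2E₁)`,
`Q = √(1 - (b²/r²)(1 - 2m₁/r))`, `D = r² + b²k²`,
`s = (br/D)(p - kQ)` and `c = (1/D)(-b²kp - r²Q)`, one has `s² + c² = 1` (so there is
a genuine angle of incidence `α` with `sin α = s`, `cos α = c`), and if `p - kQ > 0`
then `p + kc > 0` and `r s/(p + kc) = b`, inverting
`b = r sin α / (√(1+2E₁) + √(2m₁/r + 2E₁) cos α)`. -/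
theorem stmt_12 (m₁ r E₁ b p k Q D s c : ℝ)
    (hm : 0 ≤ m₁) (hr : 0 < r) (hb : 0 ≤ b)
    (h1 : 0 < 1 + 2 * E₁) (h2 : 0 ≤ 2 * m₁ / r + 2 * E₁)
    (h3 : 0 ≤ 1 - (b ^ 2 / r ^ 2) * (1 - 2 * m₁ / r))
    (hp : p = Real.sqrt (1 + 2 * E₁))
    (hk : k = Real.sqrt (2 * m₁ / r + 2 * E₁))
    (hQ : Q = Real.sqrt (1 - (b ^ 2 / r ^ 2) * (1 - 2 * m₁ / r)))
    (hD : D = r ^ 2 + b ^ 2 * k ^ 2)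
    (hs : s = (b * r / D) * (p - k * Q))
    (hc : c = (1 / D) * (-(b ^ 2 * k * p) - r ^ 2 * Q)) :
    s ^ 2 + c ^ 2 = 1 ∧
    (∃ α : ℝ, Real.sin α = s ∧ Real.cos α = c) ∧
    (0 < p - k * Q → 0 < p + k * c ∧ r * s / (p + k * c) = b) := by
  have hp2 : p ^ 2 = 1 + 2 * E₁ := by rw [hp]; exact Real.sq_sqrt h1.le
  have hk2 : k ^ 2 = 2 * m₁ / r + 2 * E₁ := by rw [hk]; exact Real.sq_sqrt h2
  have hQ2 : Q ^ 2 = 1 - (b ^ 2 / r ^ 2) * (1 - 2 * m₁ / r) := by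
    rw [hQ]; exact Real.sq_sqrt h3
  have hpk : 1 - 2 * m₁ / r = p ^ 2 - k ^ 2 := by rw [hp2, hk2]; ring
  have hrQ : r ^ 2 * Q ^ 2 = r ^ 2 - b ^ 2 * (p ^ 2 - k ^ 2) := by
    rw [hQ2, hpk]; field_simp
  have hDpos : 0 < D := by rw [hD]; positivity
  have hsD : s * D = b * r * (p - k * Q) := by rw [hs]; field_simp
  have hcD : c * D = -(b ^ 2 * k * p) - r ^ 2 * Q := by rw [hc]; field_simp
  have hone : s ^ 2 + c ^ 2 = 1 := by
    have h : (s ^ 2 + c ^ 2) * D ^ 2 = 1 * D ^ 2 := by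
      have e : (s ^ 2 + c ^ 2) * D ^ 2 = (s * D) ^ 2 + (c * D) ^ 2 := by ring
      rw [e, hsD, hcD, hD]
      linear_combination (r ^ 2 + b ^ 2 * k ^ 2) * hrQ
    exact mul_right_cancel₀ (by positivity) h
  refine ⟨hone, ?_, ?_⟩
  · have hn : ‖(⟨c, s⟩ : ℂ)‖ = 1 := by
      rw [Complex.norm_def, Complex.normSq_mk]
      rw [show c * c + s * s = 1 by linarith]; simp
    have hz : (⟨c, s⟩ : ℂ) ≠ 0 := by
      intro h; rw [h] at hn; simp at hn
    refine ⟨Complex.arg ⟨c, s⟩, ?_, ?_⟩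
    · rw [Complex.sin_arg, hn]; simp
    · rw [Complex.cos_arg hz, hn]; simp
  · intro hpos
    have hden : p + k * c = r ^ 2 * (p - k * Q) / D := by
      rw [eq_div_iff hDpos.ne']
      linear_combination k * hcD + p * hD
    have hpc : 0 < p + k * c := by rw [hden]; positivity
    refine ⟨hpc, ?_⟩
    rw [div_eq_iff hpc.ne', hden, hs]
    ring
end

section
/- Let 0 ≤ a₀ ≤ 1 and let a₁ = -3(6 - 5a₀)/7, a₂ = (8 - 5a₀)/3, a₃ = -(9 - 5a₀)/11. Then the polynomial P(y) := 1 - (5/3)a₀ y² + (7/3)a₁ y⁴ + 3a₂ y⁶ + (11/3)a₃ y⁸ is monotonically nonincreasing on the interval [0,1]; that is, P'(y) ≤ 0 for all y ∈ [0,1]. Consequently, the density profile ρ(R) = ρ_c P(R/R₁) for 0 ≤ R ≤ R₁ and ρ(R) = 0 for R > R₁ is monotonically nonincreasing on [0,∞). -/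
/-- Monotonicity of the initial density profile, Eq. (Density_profile) of the paper:
for `0 ≤ a₀ ≤ 1`, with `a₁ = -3(6-5a₀)/7`, `a₂ = (8-5a₀)/3`, `a₃ = -(9-5a₀)/11`, the
polynomial `P(y) = 1 - (5/3)a₀y² + (7/3)a₁y⁴ + 3a₂y⁶ + (11/3)a₃y⁸` satisfies
`P'(y) ≤ 0` on `[0,1]`; consequently the density
`ρ(R) = ρ_c P(R/R₁)` for `0 ≤ R ≤ R₁`, `ρ(R) = 0` for `R > R₁`, is monotonically
nonincreasing on `[0,∞)`. -/
theorem stmt_18 (a₀ a₁ a₂ a₃ R₁ ρc : ℝ) (ha₀ : 0 ≤ a₀) (ha₀' : a₀ ≤ 1)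
    (ha₁ : a₁ = -3 * (6 - 5 * a₀) / 7)
    (ha₂ : a₂ = (8 - 5 * a₀) / 3)
    (ha₃ : a₃ = -(9 - 5 * a₀) / 11)
    (hR₁ : 0 < R₁) (hρc : 0 < ρc)
    (P : ℝ → ℝ)
    (hP : P = fun y => 1 - (5 / 3) * a₀ * y ^ 2 + (7 / 3) * a₁ * y ^ 4 +
      3 * a₂ * y ^ 6 + (11 / 3) * a₃ * y ^ 8)
    (ρ : ℝ → ℝ)
    (hρ : ρ = fun R => if R ≤ R₁ then ρc * P (R / R₁) else 0) :
    (∀ y ∈ Set.Icc (0:ℝ) 1, deriv P y ≤ 0) ∧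
    AntitoneOn ρ (Set.Ici 0) := by
  have hder : ∀ y : ℝ, HasDerivAt P
      (2 * y * ((1 - y ^ 2) ^ 2 * (-12 * y ^ 2 + 5 * a₀ / 3 * (4 * y ^ 2 - 1)))) y := by
    intro y
    have h2 := (hasDerivAt_pow 2 y).const_mul ((5 / 3) * a₀)
    have h4 := (hasDerivAt_pow 4 y).const_mul ((7 / 3) * a₁)
    have h6 := (hasDerivAt_pow 6 y).const_mul (3 * a₂)
    have h8 := (hasDerivAt_pow 8 y).const_mul ((11 / 3) * a₃)
    have h := (((h2.const_sub 1).add h4).add h6).add h8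
    rw [hP]
    refine HasDerivAt.congr_deriv h ?_
    rw [ha₁, ha₂, ha₃]
    push_cast
    ring
  have hneg : ∀ y ∈ Set.Icc (0:ℝ) 1, deriv P y ≤ 0 := by
    intro y hy
    rw [(hder y).deriv]
    have h1 : -12 * y ^ 2 + 5 * a₀ / 3 * (4 * y ^ 2 - 1) ≤ 0 := by
      nlinarith [mul_nonneg (sub_nonneg.2 ha₀') (sq_nonneg y), sq_nonneg y]
    exact mul_nonpos_of_nonneg_of_nonpos (by linarith [hy.1])
      (mul_nonpos_of_nonneg_of_nonpos (sq_nonneg _) h1)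
  have hanti : AntitoneOn P (Set.Icc 0 1) := by
    apply antitoneOn_of_deriv_nonpos (convex_Icc 0 1)
    · exact fun y _ => (hder y).continuousAt.continuousWithinAt
    · exact fun y _ => (hder y).differentiableAt.differentiableWithinAt
    · exact fun y hy => hneg y (interior_subset hy)
  have hP1 : P 1 = 0 := by
    rw [hP, ha₁, ha₂, ha₃]
    ring
  refine ⟨hneg, ?_⟩
  intro x hx z hz hxz
  have hmem : ∀ w : ℝ, 0 ≤ w → w ≤ R₁ → w / R₁ ∈ Set.Icc (0:ℝ) 1 := fun w h0 h1 =>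
    ⟨div_nonneg h0 hR₁.le, (div_le_one hR₁).2 h1⟩
  have hx0 : 0 ≤ x := hx
  have hz0 : 0 ≤ z := hz
  simp only [hρ]
  by_cases hzR : z ≤ R₁
  · have hxR := hxz.trans hzR
    rw [if_pos hzR, if_pos hxR]
    exact mul_le_mul_of_nonneg_left (hanti (hmem x hx0 hxR) (hmem z hz0 hzR)
      (div_le_div_of_nonneg_right hxz hR₁.le)) hρc.le
  · rw [if_neg hzR]
    split_ifs with hxR
    · have h := hanti (hmem x hx0 hxR) (Set.right_mem_Icc.2 zero_le_one) (hmem x hx0 hxR).2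
      rw [hP1] at h
      exact mul_nonneg hρc.le h
    · exact le_rfl
end
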